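/- Let A be a ℤ-graded commutative algebra over a field k of characteristic zero, let n be an odd integer, and let Δ : A → A be a k-linear map of degree −n (Δ(A_i) ⊆ A_{i−n}) with Δ∘Δ = 0 satisfying the seven-term relation. Define, for homogeneous a, b ∈ A, {a,b} := (−1)^{|a|}(Δ(a·b) − Δ(a)·b − (−1)^{|a|} a·Δ(b)). Then {·,·} is a degree −n Lie bracket on A: {A_i, A_j} ⊆ A_{i+j−n}, the graded antisymmetry {a,b} = −(−1)^{(|a|+n)(|b|+n)}{b,a} holds, and the graded Jacobi identity {a,{b,c}} = {{a,b},c} + (−1)^{(|a|+n)(|b|+n)}{b,{a,c}} holds for all homogeneous a, b, c. -/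

import Mathlib

/-- The bracket generated by an odd operator `Δ` on a graded commutative algebra:
`{a,b} := (−1)^{|a|} (Δ(a·b) − Δ(a)·b − (−1)^{|a|} a·Δ(b))`, where `i = |a|`. -/
noncomputable def genBracket {k A : Type*} [Field k] [AddCommGroup A] [Module k A]
    (mul : A →ₗ[k] A →ₗ[k] A) (Δ : A →ₗ[k] A) (i : ℤ) (a b : A) : A :=
  (Int.negOnePow i : ℤ) •
    (Δ (mul a b) - mul (Δ a) b - (Int.negOnePow i : ℤ) • mul a (Δ b))

theorem negOnePow_ite_aux (i : ℤ) :
    ((Int.negOnePow i : ℤˣ) : ℤ) = if Even i then 1 else -1 := by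
  split_ifs with h
  · simp [Int.negOnePow_even i h]
  · simp [Int.negOnePow_odd i (Int.not_even_iff_odd.mp h)]

/-- If `A` is a ℤ-graded commutative algebra over a field of characteristic
zero, `n` is odd, and `Δ` is a degree `−n` linear map with `Δ ∘ Δ = 0` satisfying the
seven-term relation, then the derived bracket is a degree `−n` Lie bracket: it has degree
`−n`, is graded antisymmetric, and satisfies the graded Jacobi identity. -/
theorem derived_bracket_is_lie_bracket
    {k A : Type*} [Field k] [CharZero k] [AddCommGroup A] [Module k A]
    (𝒜 : ℤ → Submodule k A) (hdecomp : DirectSum.IsInternal 𝒜)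
    (mul : A →ₗ[k] A →ₗ[k] A)
    (hmul_assoc : ∀ a b c : A, mul (mul a b) c = mul a (mul b c))
    (hmul_deg : ∀ (i j : ℤ), ∀ a ∈ 𝒜 i, ∀ b ∈ 𝒜 j, mul a b ∈ 𝒜 (i + j))
    (hmul_comm : ∀ (i j : ℤ), ∀ a ∈ 𝒜 i, ∀ b ∈ 𝒜 j,
      mul a b = (Int.negOnePow (i * j) : ℤ) • mul b a)
    (n : ℤ) (hn : Odd n)
    (Δ : A →ₗ[k] A)
    (hΔ_deg : ∀ (i : ℤ), ∀ a ∈ 𝒜 i, Δ a ∈ 𝒜 (i - n))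
    (hΔ_sq : Δ ∘ₗ Δ = 0)
    (h7 : ∀ (i j l : ℤ), ∀ a ∈ 𝒜 i, ∀ b ∈ 𝒜 j, ∀ c ∈ 𝒜 l,
      Δ (mul (mul a b) c) + mul (mul (Δ a) b) c
        + (Int.negOnePow i : ℤ) • mul (mul a (Δ b)) c
        + (Int.negOnePow (i + j) : ℤ) • mul (mul a b) (Δ c)
      = mul (Δ (mul a b)) c + (Int.negOnePow i : ℤ) • mul a (Δ (mul b c))
        + (Int.negOnePow ((i + 1) * j) : ℤ) • mul b (Δ (mul a c))) :
    (∀ (i j : ℤ), ∀ a ∈ 𝒜 i, ∀ b ∈ 𝒜 j,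
      genBracket mul Δ i a b ∈ 𝒜 (i + j - n)) ∧
    (∀ (i j : ℤ), ∀ a ∈ 𝒜 i, ∀ b ∈ 𝒜 j,
      genBracket mul Δ i a b
        = -((Int.negOnePow ((i + n) * (j + n)) : ℤ) • genBracket mul Δ j b a)) ∧
    (∀ (i j l : ℤ), ∀ a ∈ 𝒜 i, ∀ b ∈ 𝒜 j, ∀ c ∈ 𝒜 l,
      genBracket mul Δ i a (genBracket mul Δ j b c)
        = genBracket mul Δ (i + j - n) (genBracket mul Δ i a b) c
          + (Int.negOnePow ((i + n) * (j + n)) : ℤ) •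
              genBracket mul Δ j b (genBracket mul Δ i a c)) := by
  have hn' : ¬ Even n := Int.not_even_iff_odd.mpr hn
  have hsq : ∀ x, Δ (Δ x) = 0 := fun x => by
    have := congrArg (fun f => f x) hΔ_sq
    simpa using this
  refine ⟨?_, ?_, ?_⟩
  · intro i j a ha b hb
    unfold genBracket
    have h1 : Δ (mul a b) ∈ 𝒜 (i + j - n) := hΔ_deg _ _ (hmul_deg _ _ _ ha _ hb)
    have h2 : mul (Δ a) b ∈ 𝒜 (i + j - n) := by
      have := hmul_deg _ _ _ (hΔ_deg _ _ ha) _ hb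
      rwa [show i - n + j = i + j - n by ring] at this
    have h3 : mul a (Δ b) ∈ 𝒜 (i + j - n) := by
      have := hmul_deg _ _ _ ha _ (hΔ_deg _ _ hb)
      rwa [show i + (j - n) = i + j - n by ring] at this
    exact zsmul_mem (sub_mem (sub_mem h1 h2) (zsmul_mem h3 _)) _
  · intro i j a ha b hb
    have c1 := hmul_comm _ _ _ hb _ ha
    have c2 := hmul_comm _ _ _ (hΔ_deg _ _ hb) _ ha
    have c3 := hmul_comm _ _ _ hb _ (hΔ_deg _ _ ha)
    unfold genBracket
    rw [c1, c2, c3]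
    simp only [negOnePow_ite_aux]
    by_cases hi : Even i <;> by_cases hj : Even j <;>
      simp [hi, hj, hn', Int.even_add, Int.even_mul, Int.even_sub] <;> abel
  · intro i j l a ha b hb c hc
    have c1 := hmul_comm _ _ _ hb _ ha
    have c2 := hmul_comm _ _ _ (hΔ_deg _ _ hb) _ ha
    have c3 := hmul_comm _ _ _ hb _ (hΔ_deg _ _ ha)
    have c4 := hmul_comm _ _ _ (hΔ_deg _ _ hb) _ (hΔ_deg _ _ ha)
    have r0 := congrArg Δ (h7 _ _ _ _ ha _ hb _ hc)
    have r1 := h7 _ _ _ _ (hΔ_deg _ _ ha) _ hb _ hc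
    have r2 := h7 _ _ _ _ ha _ (hΔ_deg _ _ hb) _ hc
    have r3 := h7 _ _ _ _ ha _ hb _ (hΔ_deg _ _ hc)
    unfold genBracket
    simp only [negOnePow_ite_aux] at *
    by_cases hi : Even i <;> by_cases hj : Even j <;>
      simp [hi, hj, hn', Int.even_add, Int.even_mul, Int.even_sub,
        ← Int.not_even_iff_odd, hsq, ← hmul_assoc] at c1 c2 c3 c4 r0 r1 r2 r3 ⊢ <;>
      simp only [c1, c2, c3, c4, map_neg, LinearMap.neg_apply] at r0 r1 r2 r3 ⊢
    · linear_combination (norm := abel) -r0 - r1 - r2 - r3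
    · linear_combination (norm := abel) r0 + r1 + r2 - r3
    · linear_combination (norm := abel) -r0 - r1 + r2 + r3
    · linear_combination (norm := abel) r0 + r1 - r2 + r3
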